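/- The maximally entangled two-qubit state attains the optimal quantum value of the Elegant Bell inequality with the stated observables: tr[ρ_AB·𝔅] = 4√3 (as a complex number equal to the real value 4√3). -/

import Mathlib

open Matrix Kronecker
open scoped ComplexOrder

noncomputable def σx : Matrix (Fin 2) (Fin 2) ℂ := !![0, 1; 1, 0]
noncomputable def σy : Matrix (Fin 2) (Fin 2) ℂ := !![0, -Complex.I; Complex.I, 0]
noncomputable def σz : Matrix (Fin 2) (Fin 2) ℂ := !![1, 0; 0, -1]

/-- Bob's observables for the Elegant Bell inequality. -/
noncomputable def B1 : Matrix (Fin 2) (Fin 2) ℂ := (Real.sqrt 3 : ℂ)⁻¹ • (σx - σy + σz)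
noncomputable def B2 : Matrix (Fin 2) (Fin 2) ℂ := (Real.sqrt 3 : ℂ)⁻¹ • (σx + σy - σz)
noncomputable def B3 : Matrix (Fin 2) (Fin 2) ℂ := (Real.sqrt 3 : ℂ)⁻¹ • (-σx - σy - σz)
noncomputable def B4 : Matrix (Fin 2) (Fin 2) ℂ := (Real.sqrt 3 : ℂ)⁻¹ • (-σx + σy + σz)

/-- The EBI Bell operator 𝔅 with Alice's observables A₁ = σx, A₂ = σy, A₃ = σz. -/
noncomputable def EBIop : Matrix (Fin 2 × Fin 2) (Fin 2 × Fin 2) ℂ :=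
  σx ⊗ₖ (B1 + B2 - B3 - B4) + σy ⊗ₖ (B1 - B2 + B3 - B4) + σz ⊗ₖ (B1 - B2 - B3 + B4)

/-- The maximally entangled two-qubit state. -/
noncomputable def ρAB : Matrix (Fin 2 × Fin 2) (Fin 2 × Fin 2) ℂ :=
  (4 : ℂ)⁻¹ • ((1 : Matrix (Fin 2) (Fin 2) ℂ) ⊗ₖ (1 : Matrix (Fin 2) (Fin 2) ℂ)
    + σx ⊗ₖ σx - σy ⊗ₖ σy + σz ⊗ₖ σz)

/-- Bob's observables combine so that the Bell operator is diagonal in the Pauli products. -/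
theorem EBIop_eq :
    EBIop = (4 * (Real.sqrt 3 : ℂ)⁻¹) • (σx ⊗ₖ σx - σy ⊗ₖ σy + σz ⊗ₖ σz) := by
  have hx : B1 + B2 - B3 - B4 = (4 * (Real.sqrt 3 : ℂ)⁻¹) • σx := by
    simp only [B1, B2, B3, B4]
    module
  have hy : B1 - B2 + B3 - B4 = -((4 * (Real.sqrt 3 : ℂ)⁻¹) • σy) := by
    simp only [B1, B2, B3, B4]
    module
  have hz : B1 - B2 - B3 + B4 = (4 * (Real.sqrt 3 : ℂ)⁻¹) • σz := by
    simp only [B1, B2, B3, B4]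
    module
  rw [EBIop, hx, hy, hz, ← neg_smul]
  simp only [kronecker_smul]
  module

/-- The correlation operator has trace `12` against four times the maximally entangled state. -/
theorem trace_one_add_pauli_mul_pauli :
    (((1 : Matrix (Fin 2) (Fin 2) ℂ) ⊗ₖ (1 : Matrix (Fin 2) (Fin 2) ℂ)
      + σx ⊗ₖ σx - σy ⊗ₖ σy + σz ⊗ₖ σz)
      * (σx ⊗ₖ σx - σy ⊗ₖ σy + σz ⊗ₖ σz)).trace = 12 := by
  simp [Matrix.trace, Matrix.mul_apply, Fintype.sum_prod_type, σx, σy, σz]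
  norm_num

/-- The maximally entangled two-qubit state attains the optimal quantum value
`4√3` of the Elegant Bell inequality with the stated observables. -/
theorem EBI_optimal_value : (ρAB * EBIop).trace = ((4 * Real.sqrt 3 : ℝ) : ℂ) := by
  rw [ρAB, EBIop_eq, smul_mul_assoc, mul_smul_comm, trace_smul, trace_smul,
    trace_one_add_pauli_mul_pauli, smul_eq_mul, smul_eq_mul]
  have h0 : (Real.sqrt 3 : ℂ) ≠ 0 := by simp
  have hsq : (Real.sqrt 3 : ℂ) ^ 2 = 3 := by
    rw [← Complex.ofReal_pow, Real.sq_sqrt (by norm_num)]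
    norm_num
  push_cast
  field_simp
  rw [hsq]
  norm_num
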